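/- Let Ω = (0,L) ⊂ ℝ, Ω₀ ⊆ Ω, 0 < δ < 2, and let φ : ℝ → [0,1] be smooth with support in Ω₀ satisfying |φ'(x)| ≤ C_φ · φ(x)^{(1+δ)/(3+δ)} for all x. Then there is a constant C > 0, independent of φ and Ω₀, such that for every u ∈ C¹(closure Ω): ∫_Ω φ² |u|^{4+δ} dx ≤ C · ‖u‖_{L¹(Ω₀)}^{2-δ} · ‖u‖_{L²(Ω₀)}^{2δ} · ∫_Ω φ² |u'|² dx + C · C_φ^{3+δ} · ‖u‖_{L¹(Ω₀)}^{4+δ}. -/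

import Mathlib

open MeasureTheory Set

lemma memLp_restrict_of_continuousOn_Icc {f : ℝ → ℝ} {a b : ℝ} (hf : ContinuousOn f (Icc a b))
    {S : Set ℝ} (hS : S ⊆ Icc a b) (p : ENNReal) : MemLp f p (volume.restrict S) := by
  obtain ⟨M, hM⟩ := isCompact_Icc.exists_bound_of_continuousOn hf
  have h : MemLp f p (volume.restrict (Icc a b)) :=
    MemLp.of_bound (hf.aestronglyMeasurable measurableSet_Icc) M
      ((ae_restrict_iff' measurableSet_Icc).2 (Filter.Eventually.of_forall hM))
  exact h.mono_measure (Measure.restrict_mono hS le_rfl)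

lemma sq_integral_mul_le {α : Type*} [MeasurableSpace α] {μ : Measure α} {f g : α → ℝ}
    (hf0 : 0 ≤ᵐ[μ] f) (hg0 : 0 ≤ᵐ[μ] g) (hf : MemLp f 2 μ) (hg : MemLp g 2 μ) :
    (∫ x, f x * g x ∂μ) ^ 2 ≤ (∫ x, f x ^ 2 ∂μ) * ∫ x, g x ^ 2 ∂μ := by
  have h := integral_mul_le_Lp_mul_Lq_of_nonneg Real.HolderConjugate.two_two hf0 hg0
    (by simpa using hf) (by simpa using hg)
  simp only [Real.rpow_two, ← Real.sqrt_eq_rpow] at h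
  have h0 : 0 ≤ ∫ x, f x * g x ∂μ := integral_nonneg_of_ae <| by
    filter_upwards [hf0, hg0] with x h1 h2 using mul_nonneg h1 h2
  calc (∫ x, f x * g x ∂μ) ^ 2 ≤ (√(∫ x, f x ^ 2 ∂μ) * √(∫ x, g x ^ 2 ∂μ)) ^ 2 := by gcongr
    _ = _ := by
      rw [mul_pow, Real.sq_sqrt (integral_nonneg fun _ => sq_nonneg _),
        Real.sq_sqrt (integral_nonneg fun _ => sq_nonneg _)]

lemma sq_integral_rpow_le_interpolation {u : ℝ → ℝ} {a b δ : ℝ} (hδ : δ ∈ Ioo (0 : ℝ) 2)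
    (hu : ContinuousOn u (Icc a b)) {S : Set ℝ} (hS : S ⊆ Icc a b) :
    (∫ x in S, |u x| ^ (1 + δ / 2)) ^ 2
      ≤ (∫ x in S, |u x|) ^ (2 - δ) * (∫ x in S, u x ^ 2) ^ δ := by
  obtain ⟨h0, h2⟩ := hδ
  have hpq : (1 / (1 - δ / 2)).HolderConjugate (2 / δ) := by
    rw [Real.holderConjugate_iff]
    refine ⟨?_, ?_⟩
    · rw [lt_div_iff₀ (by linarith)]; linarith
    · simp
  have hc1 : ContinuousOn (fun x => |u x| ^ (1 - δ / 2)) (Icc a b) :=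
    hu.abs.rpow_const fun x _ => Or.inr (by linarith)
  have hc2 : ContinuousOn (fun x => |u x| ^ δ) (Icc a b) :=
    hu.abs.rpow_const fun x _ => Or.inr h0.le
  have h := integral_mul_le_Lp_mul_Lq_of_nonneg hpq (μ := volume.restrict S)
    (f := fun x => |u x| ^ (1 - δ / 2)) (g := fun x => |u x| ^ δ)
    (Filter.Eventually.of_forall fun x => by positivity)
    (Filter.Eventually.of_forall fun x => by positivity)
    (memLp_restrict_of_continuousOn_Icc hc1 hS _) (memLp_restrict_of_continuousOn_Icc hc2 hS _)
  have e1 : ∀ x, |u x| ^ (1 - δ / 2) * |u x| ^ δ = |u x| ^ (1 + δ / 2) := fun x => by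
    rw [← Real.rpow_add_of_nonneg (abs_nonneg _) (by linarith) h0.le]; ring_nf
  have e2 : ∀ x, (|u x| ^ (1 - δ / 2)) ^ (1 / (1 - δ / 2)) = |u x| := fun x => by
    rw [← Real.rpow_mul (abs_nonneg _), mul_one_div_cancel (by linarith), Real.rpow_one]
  have e3 : ∀ x, (|u x| ^ δ) ^ (2 / δ) = u x ^ 2 := fun x => by
    rw [← Real.rpow_mul (abs_nonneg _), mul_div_cancel₀ _ h0.ne', Real.rpow_two, sq_abs]
  simp only [e1, e2, e3, one_div_div, div_one] at h
  have hK : 0 ≤ ∫ x in S, |u x| := integral_nonneg fun _ => abs_nonneg _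
  have hN : 0 ≤ ∫ x in S, u x ^ 2 := integral_nonneg fun _ => sq_nonneg _
  have hR : 0 ≤ ∫ x in S, |u x| ^ (1 + δ / 2) := integral_nonneg fun _ => by positivity
  calc _ ≤ ((∫ x in S, |u x|) ^ (1 - δ / 2) * (∫ x in S, u x ^ 2) ^ (δ / 2)) ^ 2 := by gcongr
    _ = _ := by
      rw [mul_pow, ← Real.rpow_mul_natCast hK, ← Real.rpow_mul_natCast hN]
      congr 2 <;> push_cast <;> ring

lemma exists_last_level_point {g : ℝ → ℝ} {a b σ : ℝ} (hab : a ≤ b)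
    (hg : ContinuousOn g (Icc a b)) (ha : g a ≤ σ) (hb : σ ≤ g b) :
    ∃ c ∈ Icc a b, g c = σ ∧ ∀ y ∈ Icc c b, σ ≤ g y := by
  have hK : IsCompact (Icc a b ∩ g ⁻¹' {σ}) :=
    isCompact_Icc.of_isClosed_subset
      (hg.preimage_isClosed_of_isClosed isClosed_Icc isClosed_singleton) inter_subset_left
  obtain ⟨z, hz, hzσ⟩ := intermediate_value_Icc hab hg ⟨ha, hb⟩
  obtain ⟨hc, hcσ⟩ := hK.sSup_mem ⟨z, hz, hzσ⟩
  refine ⟨_, hc, hcσ, fun y hy => ?_⟩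
  by_contra! hlt
  obtain ⟨w, hw, hwσ⟩ := intermediate_value_Icc hy.2
    (hg.mono (Icc_subset_Icc_left (hc.1.trans hy.1))) ⟨hlt.le, hb⟩
  have hwc := le_csSup hK.bddAbove ⟨⟨hc.1.trans (hy.1.trans hw.1), hw.2⟩, hwσ⟩
  have : w = y := le_antisymm (hwc.trans hy.1) hw.1
  rw [this] at hwσ
  exact hlt.ne hwσ

lemma le_exp_one_mul_of_abs_deriv_le {φ w : ℝ → ℝ} {a b : ℝ} (hab : a ≤ b)
    (hφ : Differentiable ℝ φ) (hpos : ∀ y ∈ Icc a b, 0 < φ y)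
    (hw : ContinuousOn w (Icc a b)) (hd : ∀ y ∈ Icc a b, |deriv φ y| ≤ φ y * w y)
    (hint : ∫ y in a..b, w y ≤ 1) : φ b ≤ Real.exp 1 * φ a := by
  have h := norm_sub_le_integral_of_norm_deriv_le_of_le
    (f := fun y => Real.log (φ y)) hab
    (hφ.continuous.continuousOn.log fun y hy => (hpos y hy).ne')
    (fun y hy => ((hφ y).log (hpos y (Ioo_subset_Icc_self hy)).ne').differentiableWithinAt)
    (B := w) (Filter.Eventually.of_forall fun y hy => by
      have hy' := Ioo_subset_Icc_self hy
      have hp := hpos y hy'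
      rw [deriv.log (hφ y) hp.ne', Real.norm_eq_abs, abs_div, abs_of_pos hp, div_le_iff₀ hp,
        mul_comm]
      exact hd y hy')
    (hw.intervalIntegrable_of_Icc hab)
  have h1 : Real.log (φ b) ≤ 1 + Real.log (φ a) := by
    have := (le_abs_self _).trans h
    linarith
  have ha := hpos a (left_mem_Icc.2 hab)
  have hb := hpos b (right_mem_Icc.2 hab)
  rw [← Real.exp_log ha, ← Real.exp_add, ← Real.exp_log hb]
  exact Real.exp_le_exp.2 h1

lemma sq_mul_rpow_le_of_comparable {u v φ : ℝ → ℝ} {a b q A : ℝ} (hab : a ≤ b) (hq : 1 < q)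
    (hu : ContinuousOn u (Icc a b)) (hv : ContinuousOn v (Icc a b))
    (hd : ∀ y ∈ Ioo a b, HasDerivAt u (v y) y)
    (hφ : ContinuousOn φ (Icc a b)) (hφ0 : ∀ y ∈ Icc a b, 0 ≤ φ y)
    (hcmp : ∀ y ∈ Icc a b, φ b ≤ A * φ y) (hua : 2 * |u a| ≤ |u b|) :
    φ b ^ 2 * |u b| ^ (2 * q) ≤ 4 * q ^ 2 * A ^ 2 *
      ((∫ y in Ioc a b, φ y ^ 2 * |v y| ^ 2) * ∫ y in Ioc a b, |u y| ^ (2 * q - 2)) := by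
  have hφb := hφ0 b (right_mem_Icc.2 hab)
  have hcu : ContinuousOn (fun y => |u y| ^ (q - 1)) (Icc a b) :=
    hu.abs.rpow_const fun x _ => Or.inr (by linarith)
  have hderiv : ∀ y ∈ Ioo a b,
      HasDerivAt (fun y => |u y| ^ q) (q * |u y| ^ (q - 2) * u y * v y) y := fun y hy =>
    (hasDerivAt_abs_rpow (u y) hq).comp y (hd y hy)
  have hnorm : ∀ y, ‖q * |u y| ^ (q - 2) * u y * v y‖ = q * (|u y| ^ (q - 1) * |v y|) := by
    intro y
    rw [Real.norm_eq_abs, abs_mul, abs_mul, abs_mul, abs_of_pos (by linarith : 0 < q),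
      abs_of_nonneg (Real.rpow_nonneg (abs_nonneg _) _)]
    rcases eq_or_ne (u y) 0 with h0 | h0
    · simp [h0, Real.zero_rpow (by linarith : q - 1 ≠ 0)]
    · have : |u y| ^ (q - 1) = |u y| ^ (q - 2) * |u y| := by
        rw [← Real.rpow_add_one (abs_ne_zero.2 h0)]; ring_nf
      rw [this]; ring
  have h := norm_sub_le_integral_of_norm_deriv_le_of_le
    (f := fun y => |u y| ^ q) hab (hu.abs.rpow_const fun x _ => Or.inr (by linarith))
    (fun y hy => (hderiv y hy).differentiableAt.differentiableWithinAt)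
    (B := fun y => q * (|u y| ^ (q - 1) * |v y|)) (Filter.Eventually.of_forall fun y hy => by
      rw [(hderiv y hy).deriv, hnorm])
    ((continuousOn_const.mul (hcu.mul hv.abs)).intervalIntegrable_of_Icc hab)
  rw [intervalIntegral.integral_const_mul, intervalIntegral.integral_of_le hab] at h
  have hhalf : |u a| ^ q ≤ |u b| ^ q / 2 := by
    have h1 : (2 * |u a|) ^ q ≤ |u b| ^ q := by gcongr
    rw [Real.mul_rpow (by norm_num) (abs_nonneg _)] at h1
    have h2 : (2 : ℝ) ≤ 2 ^ q := Real.self_le_rpow_of_one_le (by norm_num) hq.le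
    have h3 : 0 ≤ |u a| ^ q := by positivity
    nlinarith
  have hub : |u b| ^ q ≤ 2 * (q * ∫ y in Ioc a b, |u y| ^ (q - 1) * |v y|) := by
    have := (le_abs_self _).trans h
    linarith
  set f : ℝ → ℝ := fun y => φ y * |v y|
  have hcf : ContinuousOn f (Icc a b) := hφ.mul hv.abs
  have hf2 := memLp_restrict_of_continuousOn_Icc hcf Ioc_subset_Icc_self
  have hg2 := memLp_restrict_of_continuousOn_Icc hcu Ioc_subset_Icc_self
  have hweight : φ b * ∫ y in Ioc a b, |u y| ^ (q - 1) * |v y|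
      ≤ A * ∫ y in Ioc a b, f y * |u y| ^ (q - 1) := by
    rw [← integral_const_mul, ← integral_const_mul]
    refine setIntegral_mono_on ?_ ?_ measurableSet_Ioc fun y hy => ?_
    · exact ((continuousOn_const.mul (hcu.mul hv.abs)).integrableOn_Icc).mono_set
        Ioc_subset_Icc_self
    · exact ((continuousOn_const.mul (hcf.mul hcu)).integrableOn_Icc).mono_set
        Ioc_subset_Icc_self
    · have := hcmp y (Ioc_subset_Icc_self hy)
      calc φ b * (|u y| ^ (q - 1) * |v y|) ≤ (A * φ y) * (|u y| ^ (q - 1) * |v y|) := by gcongr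
        _ = _ := by simp only [f]; ring
  have hcs := sq_integral_mul_le (μ := volume.restrict (Ioc a b)) (f := f)
    (g := fun y => |u y| ^ (q - 1))
    ((ae_restrict_iff' measurableSet_Ioc).2 <| Filter.Eventually.of_forall fun y hy =>
      mul_nonneg (hφ0 y (Ioc_subset_Icc_self hy)) (abs_nonneg _))
    (Filter.Eventually.of_forall fun y => by positivity) (hf2 2) (hg2 2)
  have e1 : ∀ y, f y ^ 2 = φ y ^ 2 * |v y| ^ 2 := fun y => mul_pow _ _ _
  have e2 : ∀ y, (|u y| ^ (q - 1)) ^ 2 = |u y| ^ (2 * q - 2) := fun y => by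
    rw [← Real.rpow_mul_natCast (abs_nonneg _)]; push_cast; ring_nf
  simp only [e1, e2] at hcs
  have e3 : |u b| ^ (2 * q) = (|u b| ^ q) ^ 2 := by
    rw [← Real.rpow_mul_natCast (abs_nonneg _)]; push_cast; ring_nf
  calc φ b ^ 2 * |u b| ^ (2 * q) = (φ b * |u b| ^ q) ^ 2 := by rw [e3]; ring
    _ ≤ (2 * q * (A * ∫ y in Ioc a b, f y * |u y| ^ (q - 1))) ^ 2 := by
      have : φ b * |u b| ^ q ≤ 2 * q * (A * ∫ y in Ioc a b, f y * |u y| ^ (q - 1)) := by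
        calc φ b * |u b| ^ q ≤ φ b * (2 * (q * ∫ y in Ioc a b, |u y| ^ (q - 1) * |v y|)) := by
              gcongr
          _ = 2 * q * (φ b * ∫ y in Ioc a b, |u y| ^ (q - 1) * |v y|) := by ring
          _ ≤ _ := by gcongr
      gcongr
    _ = 4 * q ^ 2 * A ^ 2 * (∫ y in Ioc a b, f y * |u y| ^ (q - 1)) ^ 2 := by ring
    _ ≤ _ := by gcongr

lemma sq_mul_rpow_le_of_peak {L δ Cφ K : ℝ} (hδ : δ ∈ Ioo (0 : ℝ) 2) {S : Set ℝ}
    (hSL : S ⊆ Ioo 0 L) {φ u : ℝ → ℝ} (hC : 0 < Cφ)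
    (hφ : Differentiable ℝ φ) (hφ0 : ∀ x, 0 ≤ φ x) (hsupp : Function.support φ ⊆ S)
    (hdφ : ∀ x, |deriv φ x| ≤ Cφ * φ x ^ ((1 + δ) / (3 + δ)))
    (hu : ContDiffOn ℝ 1 u (Icc 0 L)) (hK0 : 0 < K) (hK : ∫ x in S, |u x| ≤ K) {x : ℝ}
    (hx : x ∈ S) (hpeak : 2 * Real.exp 1 * (Cφ * K) < φ x ^ (2 / (3 + δ)) * |u x|) :
    φ x ^ 2 * |u x| ^ (3 + δ / 2) ≤ 4 * ((6 + δ) / 4) ^ 2 * Real.exp 1 ^ 2 *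
      ((∫ y in Ioo 0 L, φ y ^ 2 * |derivWithin u (Icc 0 L) y| ^ 2) *
        ∫ y in S, |u y| ^ (1 + δ / 2)) := by
  obtain ⟨hδ0, hδ2⟩ := hδ
  set s : ℝ := 2 / (3 + δ) with hs
  have hs0 : 0 < s := by positivity
  have hs1 : s ≤ 1 := by rw [hs, div_le_one (by linarith)]; linarith
  have hxL := hSL hx
  have hσ : 0 < Cφ * K := by positivity
  have huc : ContinuousOn u (Icc 0 L) := hu.continuousOn
  have hvc : ContinuousOn (derivWithin u (Icc 0 L)) (Icc 0 L) :=
    hu.continuousOn_derivWithin (uniqueDiffOn_Icc (hxL.1.trans hxL.2)) le_rfl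
  have hφ_zero : φ 0 = 0 := by
    by_contra h
    exact lt_irrefl _ (hSL (hsupp h)).1
  have hgc : ContinuousOn (fun y => φ y ^ s * |u y|) (Icc 0 x) :=
    (hφ.continuous.continuousOn.rpow_const fun y _ => Or.inr hs0.le).mul
      (huc.mono (Icc_subset_Icc_right hxL.2.le)).abs
  have he : 2 ≤ Real.exp 1 := by have := Real.add_one_le_exp (1 : ℝ); linarith
  obtain ⟨a, ha, hga, hg⟩ := exists_last_level_point (σ := Cφ * K) hxL.1.le hgc
    (by simp [hφ_zero, Real.zero_rpow hs0.ne', hσ.le]) (by nlinarith)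
  have hpos : ∀ y ∈ Icc a x, 0 < φ y := fun y hy => by
    refine (hφ0 y).lt_of_ne' fun h => ?_
    have := hg y hy
    simp only [h, Real.zero_rpow hs0.ne', zero_mul] at this
    linarith
  have hJS : Icc a x ⊆ S := fun y hy => hsupp (hpos y hy).ne'
  have hJL : Icc a x ⊆ Icc 0 L := hJS.trans (hSL.trans Ioo_subset_Icc_self)
  have hcmp : ∀ y ∈ Icc a x, φ x ≤ Real.exp 1 * φ y := fun y hy => by
    have hsub : Icc y x ⊆ Icc a x := Icc_subset_Icc_left hy.1
    refine le_exp_one_mul_of_abs_deriv_le (w := fun z => |u z| / K) hy.2 hφ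
      (fun z hz => hpos z (hsub hz)) ((huc.mono (hsub.trans hJL)).abs.div_const _)
      (fun z hz => ?_) ?_
    · have hz' := hsub hz
      have hp := hpos z hz'
      have hgz := hg z hz'
      have e : φ z ^ ((1 + δ) / (3 + δ)) * φ z ^ s = φ z := by
        rw [← Real.rpow_add hp, hs, ← add_div,
          show (1 + δ + 2) / (3 + δ) = 1 by rw [div_eq_one_iff_eq (by linarith)]; ring,
          Real.rpow_one]
      refine (hdφ z).trans ?_
      rw [mul_div_assoc', le_div_iff₀ hK0]
      have hp' : 0 < φ z ^ ((1 + δ) / (3 + δ)) := by positivity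
      calc Cφ * φ z ^ ((1 + δ) / (3 + δ)) * K
          = φ z ^ ((1 + δ) / (3 + δ)) * (Cφ * K) := by ring
        _ ≤ φ z ^ ((1 + δ) / (3 + δ)) * (φ z ^ s * |u z|) := by gcongr
        _ = φ z * |u z| := by rw [← mul_assoc, e]
    · rw [intervalIntegral.integral_div, div_le_one hK0, intervalIntegral.integral_of_le hy.2]
      refine le_trans (setIntegral_mono_set ?_ ?_ ?_) hK
      · exact (huc.abs.integrableOn_Icc).mono_set (hSL.trans Ioo_subset_Icc_self)
      · exact Filter.Eventually.of_forall fun _ => abs_nonneg _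
      · exact (Ioc_subset_Icc_self.trans (hsub.trans hJS)).eventuallyLE
  have hua : 2 * |u a| ≤ |u x| := by
    have h1 : φ x ^ s ≤ Real.exp 1 * φ a ^ s := by
      calc φ x ^ s ≤ (Real.exp 1 * φ a) ^ s := by
            have := hcmp a (left_mem_Icc.2 ha.2)
            have := hφ0 x
            gcongr
        _ = Real.exp 1 ^ s * φ a ^ s := Real.mul_rpow (by positivity) (hφ0 a)
        _ ≤ Real.exp 1 * φ a ^ s := by
            have := Real.rpow_le_self_of_one_le (by linarith : 1 ≤ Real.exp 1) hs1
            have := hφ0 a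
            gcongr
    have hpx : 0 < φ x ^ s := Real.rpow_pos_of_pos (hpos x (right_mem_Icc.2 ha.2)) _
    refine le_of_mul_le_mul_left ?_ hpx
    calc φ x ^ s * (2 * |u a|) ≤ Real.exp 1 * φ a ^ s * (2 * |u a|) := by gcongr
      _ = 2 * Real.exp 1 * (φ a ^ s * |u a|) := by ring
      _ ≤ _ := by rw [hga]; exact hpeak.le
  have hmain := sq_mul_rpow_le_of_comparable (q := (6 + δ) / 4) ha.2 (by linarith)
    (huc.mono hJL) (hvc.mono hJL) (fun y hy => by
      have hyL := hSL (hJS (Ioo_subset_Icc_self hy))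
      have hn : Icc 0 L ∈ nhds y := Icc_mem_nhds hyL.1 hyL.2
      exact ((hu.differentiableOn one_ne_zero y
        (Ioo_subset_Icc_self hyL)).hasDerivWithinAt).hasDerivAt hn)
    hφ.continuous.continuousOn (fun y _ => hφ0 y) hcmp hua
  rw [show 2 * ((6 + δ) / 4) = 3 + δ / 2 by ring, show 3 + δ / 2 - 2 = 1 + δ / 2 by ring] at hmain
  refine hmain.trans ?_
  have hJ : Ioc a x ⊆ S := Ioc_subset_Icc_self.trans hJS
  gcongr
  · exact Filter.Eventually.of_forall fun _ => by positivity
  · exact ((((hφ.continuous.continuousOn.pow 2).mul (hvc.abs.pow 2))).integrableOn_Icc).mono_set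
      Ioo_subset_Icc_self
  · exact hJ.trans hSL
  · exact Filter.Eventually.of_forall fun _ => by positivity
  · exact ((huc.abs.rpow_const fun x _ => Or.inr (by linarith)).integrableOn_Icc).mono_set
      (hSL.trans Ioo_subset_Icc_self)

theorem stmt_1 (L : ℝ) (hL : 0 < L) (δ : ℝ) (hδ : δ ∈ Ioo (0:ℝ) 2) :
    ∃ C > 0, ∀ (Ω₀ : Set ℝ), MeasurableSet Ω₀ → Ω₀ ⊆ Ioo 0 L →
      ∀ (φ : ℝ → ℝ) (Cφ : ℝ), 0 < Cφ → ContDiff ℝ (⊤ : ℕ∞) φ →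
        (∀ x, φ x ∈ Icc (0:ℝ) 1) → Function.support φ ⊆ Ω₀ →
        (∀ x, |deriv φ x| ≤ Cφ * (φ x) ^ ((1 + δ)/(3 + δ))) →
        ∀ u : ℝ → ℝ, ContDiffOn ℝ 1 u (Icc 0 L) →
          ∫ x in Ioo 0 L, (φ x) ^ 2 * |u x| ^ ((4:ℝ) + δ)
            ≤ C * (∫ x in Ω₀, |u x|) ^ ((2:ℝ) - δ) * (∫ x in Ω₀, (u x) ^ 2) ^ δ *
                (∫ x in Ioo 0 L, (φ x) ^ 2 * |derivWithin u (Icc 0 L) x| ^ 2)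
              + C * Cφ ^ ((3:ℝ) + δ) * (∫ x in Ω₀, |u x|) ^ ((4:ℝ) + δ) := by
  obtain ⟨hδ0, hδ2⟩ := id hδ
  set C₁ : ℝ := 4 * ((6 + δ) / 4) ^ 2 * Real.exp 1 ^ 2
  set C₂ : ℝ := (2 * Real.exp 1) ^ (3 + δ)
  have hC₁ : 0 < C₁ := by positivity
  have hC₂ : 0 < C₂ := by positivity
  refine ⟨C₁ + C₂, by positivity, fun Ω₀ hS hSL φ Cφ hC hφ hφ01 hsupp hdφ u hu => ?_⟩
  have hφ0 : ∀ x, 0 ≤ φ x := fun x => (hφ01 x).1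
  have hφd : Differentiable ℝ φ := hφ.differentiable (by simp)
  have huc : ContinuousOn u (Icc 0 L) := hu.continuousOn
  have hSI : Ω₀ ⊆ Icc 0 L := hSL.trans Ioo_subset_Icc_self
  have hint : ∀ r : ℝ, 0 ≤ r → IntegrableOn (fun x => |u x| ^ r) Ω₀ := fun r hr =>
    ((huc.abs.rpow_const fun x _ => Or.inr hr).integrableOn_Icc).mono_set hSI
  have hintK : IntegrableOn (fun x => |u x|) Ω₀ := (huc.abs.integrableOn_Icc).mono_set hSI
  have hinterp := sq_integral_rpow_le_interpolation hδ huc hSI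
  have hpeak := fun K => sq_mul_rpow_le_of_peak (K := K) hδ hSL hC hφd hφ0 hsupp hdφ hu
  rw [setIntegral_eq_of_subset_of_forall_sdiff_eq_zero measurableSet_Ioo hSL fun x hx => by
    rw [Function.notMem_support.1 fun h => hx.2 (hsupp h)]; simp]
  have hK : 0 ≤ ∫ x in Ω₀, |u x| := integral_nonneg fun _ => abs_nonneg _
  have hN : 0 ≤ ∫ x in Ω₀, u x ^ 2 := integral_nonneg fun _ => sq_nonneg _
  have hD : 0 ≤ ∫ x in Ioo 0 L, φ x ^ 2 * |derivWithin u (Icc 0 L) x| ^ 2 :=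
    integral_nonneg fun _ => by positivity
  set K := ∫ x in Ω₀, |u x| with hKdef
  set N := ∫ x in Ω₀, u x ^ 2
  set D := ∫ x in Ioo 0 L, φ x ^ 2 * |derivWithin u (Icc 0 L) x| ^ 2
  set R := ∫ x in Ω₀, |u x| ^ (1 + δ / 2)
  rcases hK.eq_or_lt' with hK0 | hK0
  · have hae := (setIntegral_eq_zero_iff_of_nonneg_ae
      (Filter.Eventually.of_forall fun _ => abs_nonneg _) hintK).1 hK0
    rw [integral_eq_zero_of_ae]
    · positivity
    · filter_upwards [hae] with x hx
      simp only [Pi.zero_apply] at hx ⊢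
      rw [hx, Real.zero_rpow (by linarith), mul_zero]
  have hpt : ∀ x ∈ Ω₀, φ x ^ 2 * |u x| ^ (4 + δ)
      ≤ C₁ * (D * R) * |u x| ^ (1 + δ / 2) + C₂ * (Cφ * K) ^ (3 + δ) * |u x| := fun x hx => by
    have hR : 0 ≤ R := integral_nonneg fun _ => by positivity
    by_cases h : 2 * Real.exp 1 * (Cφ * K) < φ x ^ (2 / (3 + δ)) * |u x|
    · refine le_add_of_le_of_nonneg ?_ (by positivity)
      rw [show (4 : ℝ) + δ = (3 + δ / 2) + (1 + δ / 2) by ring,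
        Real.rpow_add_of_nonneg (abs_nonneg _) (by linarith) (by linarith), ← mul_assoc]
      have := hpeak K hK0 le_rfl hx h
      gcongr
    · refine le_add_of_nonneg_of_le (by positivity) ?_
      rw [not_lt] at h
      have h1 : (φ x ^ (2 / (3 + δ)) * |u x|) ^ (3 + δ) = φ x ^ 2 * |u x| ^ (3 + δ) := by
        rw [Real.mul_rpow (Real.rpow_nonneg (hφ0 x) _) (abs_nonneg _), ← Real.rpow_mul (hφ0 x),
          div_mul_cancel₀ _ (by linarith), Real.rpow_two]
      have h2 : (φ x ^ (2 / (3 + δ)) * |u x|) ^ (3 + δ)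
          ≤ (2 * Real.exp 1 * (Cφ * K)) ^ (3 + δ) := by
        have := Real.rpow_nonneg (hφ0 x) (2 / (3 + δ))
        gcongr
      rw [h1, Real.mul_rpow (by positivity) (by positivity)] at h2
      rw [show (4 : ℝ) + δ = (3 + δ) + 1 by ring,
        Real.rpow_add_of_nonneg (abs_nonneg _) (by linarith) zero_le_one, Real.rpow_one,
        ← mul_assoc]
      gcongr
  have hi1 := (hint (1 + δ / 2) (by linarith)).const_mul (C₁ * (D * R))
  have hi2 := hintK.const_mul (C₂ * (Cφ * K) ^ (3 + δ))
  calc ∫ x in Ω₀, φ x ^ 2 * |u x| ^ (4 + δ)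
      ≤ ∫ x in Ω₀, (C₁ * (D * R) * |u x| ^ (1 + δ / 2) + C₂ * (Cφ * K) ^ (3 + δ) * |u x|) :=
        setIntegral_mono_on
          ((((hφd.continuous.continuousOn.pow 2).mul
            (huc.abs.rpow_const fun x _ => Or.inr (by linarith))).integrableOn_Icc).mono_set hSI)
          (hi1.add hi2) hS hpt
    _ = C₁ * D * R ^ 2 + C₂ * (Cφ ^ (3 + δ) * K ^ (4 + δ)) := by
        rw [integral_add hi1 hi2, integral_const_mul, integral_const_mul, ← hKdef,
          Real.mul_rpow hC.le hK, show (4 : ℝ) + δ = (3 + δ) + 1 by ring,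
          Real.rpow_add_one hK0.ne']
        ring
    _ ≤ (C₁ + C₂) * D * (K ^ (2 - δ) * N ^ δ) + (C₁ + C₂) * (Cφ ^ (3 + δ) * K ^ (4 + δ)) := by
        gcongr <;> linarith
    _ = _ := by ring
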